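/- arXiv:2008.01406 — 2 statements merged into one kernel-verified Lean document; each statement's English description precedes it below -/
import Mathlib

section
/- Let A ≥ 1, let (X,d) be an A-uniform metric space with d(x) > 0 for every x ∈ X, let k be its quasihyperbolic metric, and let p ∈ X. If {x_i} is a sequence in X such that (x_i|x_j)^k_p → ∞ as i, j → ∞ and sup_i d(x_i, p) < ∞, then {x_i} is a Cauchy sequence with respect to the metric d. -/
open Metric Filter Set

noncomputable section

universe u v

/-- Gromov product of `x` and `y` with respect to base point `w`,
for a real-valued distance kernel `ρ`. -/
def gromovProd {X : Type u} (ρ : X → X → ℝ) (w x y : X) : ℝ :=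
  (ρ x w + ρ y w - ρ x y) / 2

/-- `(X, ρ)` is δ-hyperbolic. -/
def IsDeltaHyp {X : Type u} (ρ : X → X → ℝ) (δ : ℝ) : Prop :=
  ∀ x y z w : X, gromovProd ρ w x y ≥ min (gromovProd ρ w x z) (gromovProd ρ w z y) - δ

/-- `f` is a (λ,μ)-rough similarity. -/
def RoughSimilarity {X : Type u} {Y : Type v} [MetricSpace X] [MetricSpace Y]
    (lam mu : ℝ) (f : X → Y) : Prop :=
  (∀ y : Y, ∃ x : X, dist y (f x) ≤ mu) ∧
  (∀ x x' : X, lam * dist x x' - mu ≤ dist (f x) (f x') ∧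
    dist (f x) (f x') ≤ lam * dist x x' + mu)

/-- The distance from `x ∈ X` to the metric boundary `∂X = X̄ \ X`. -/
def distToBdry (X : Type u) [MetricSpace X] (x : X) : ℝ :=
  Metric.infDist (x : UniformSpace.Completion X)
    (Set.range ((↑) : X → UniformSpace.Completion X))ᶜ

/-- `X` is noncomplete, i.e. `∂X = X̄ \ X ≠ ∅`. -/
def IsNoncomplete (X : Type u) [MetricSpace X] : Prop :=
  ((Set.range ((↑) : X → UniformSpace.Completion X))ᶜ).Nonempty

/-- Ibragimov's hyperbolization metric. -/
def hMetric (X : Type u) [MetricSpace X] (x y : X) : ℝ :=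
  2 * Real.log ((dist x y + max (distToBdry X x) (distToBdry X y)) /
    Real.sqrt (distToBdry X x * distToBdry X y))

/-- The j̃-metric. -/
def jtMetric (X : Type u) [MetricSpace X] (x y : X) : ℝ :=
  (1 / 2) * Real.log ((1 + dist x y / distToBdry X x) * (1 + dist x y / distToBdry X y))

/-- The quasihyperbolic metric. -/
def quasihyperbolic (X : Type u) [MetricSpace X] (x y : X) : ℝ :=
  sInf {r : ℝ | ∃ L : ℝ, 0 ≤ L ∧ ∃ γ : ℝ → X,
    LipschitzOnWith 1 γ (Set.Icc 0 L) ∧ γ 0 = x ∧ γ L = y ∧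
    r = ∫ t in (0:ℝ)..L, (distToBdry X (γ t))⁻¹}

/-- `X` is an `A`-uniform metric space. -/
def IsUniformMS (X : Type u) [MetricSpace X] (A : ℝ) : Prop :=
  ∀ x y : X, ∃ L : ℝ, 0 ≤ L ∧ ∃ γ : ℝ → X,
    LipschitzOnWith 1 γ (Set.Icc 0 L) ∧ γ 0 = x ∧ γ L = y ∧
    L ≤ A * dist x y ∧ ∀ t ∈ Set.Icc (0:ℝ) L, min t (L - t) ≤ A * distToBdry X (γ t)

/-- `X` is unbounded. -/
def IsUnbounded (X : Type u) [MetricSpace X] : Prop :=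
  ¬ Bornology.IsBounded (Set.univ : Set X)

variable {X : Type u} [MetricSpace X]

lemma distToBdry_le_add_dist (x y : X) : distToBdry X x ≤ distToBdry X y + dist x y := by
  unfold distToBdry
  rw [← UniformSpace.Completion.dist_eq x y]
  exact Metric.infDist_le_infDist_add_dist

lemma continuous_distToBdry : Continuous (distToBdry X) :=
  (Metric.continuous_infDist_pt _).comp (UniformSpace.Completion.continuous_coe X)

lemma lipschitz_comp_projIcc {γ : ℝ → X} {L : ℝ} (hL : 0 ≤ L)
    (hγ : LipschitzOnWith 1 γ (Set.Icc 0 L)) :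
    LipschitzWith 1 (fun t => γ (Set.projIcc 0 L hL t)) := by
  have h := hγ.to_restrict.comp (LipschitzWith.projIcc hL)
  rw [mul_one] at h
  exact h

lemma lipschitzWith_const_sub (c : ℝ) : LipschitzWith 1 (fun t : ℝ => c - t) :=
  LipschitzWith.of_dist_le_mul fun s t => by
    rw [NNReal.coe_one, one_mul, dist_sub_left]

lemma dist_le_sub_of_lipschitz {γ : ℝ → X} (hγ : LipschitzWith 1 γ) {s t : ℝ} (h : s ≤ t) :
    dist (γ s) (γ t) ≤ t - s := by
  have := hγ.dist_le_mul s t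
  rwa [NNReal.coe_one, one_mul, Real.dist_eq, abs_sub_comm, abs_of_nonneg (by linarith)] at this

section

variable (hd : ∀ x : X, 0 < distToBdry X x)
include hd

lemma continuous_inv_distToBdry {γ : ℝ → X} (hγ : LipschitzWith 1 γ) :
    Continuous (fun t => (distToBdry X (γ t))⁻¹) :=
  (continuous_distToBdry.comp hγ.continuous).inv₀ fun _ => ne_of_gt (hd _)

/-- The quasihyperbolic distance is at most the quasihyperbolic length of any 1-Lipschitz arc. -/
lemma quasihyperbolic_le_integral {γ : ℝ → X} (hγ : LipschitzWith 1 γ) {a b : ℝ} (hab : a ≤ b) :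
    quasihyperbolic X (γ a) (γ b) ≤ ∫ t in a..b, (distToBdry X (γ t))⁻¹ := by
  refine csInf_le ⟨0, ?_⟩ ⟨b - a, by linarith, fun t => γ (t + a), ?_, by simp, by simp, ?_⟩
  · rintro r ⟨L, hL, γ, -, -, -, rfl⟩
    exact intervalIntegral.integral_nonneg hL fun t _ => (inv_pos.2 (hd _)).le
  · have : LipschitzWith 1 (fun t : ℝ => t + a) := LipschitzWith.of_dist_le_mul (by simp)
    have h := (hγ.comp this).lipschitzOnWith (s := Set.Icc 0 (b - a))
    rwa [mul_one] at h
  · rw [intervalIntegral.integral_comp_add_right (fun t => (distToBdry X (γ t))⁻¹) a]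
    simp

end

lemma exists_uniform_curve {A : ℝ} (hXA : IsUniformMS X A) (x y : X) :
    ∃ L : ℝ, 0 ≤ L ∧ ∃ γ : ℝ → X, LipschitzWith 1 γ ∧ γ 0 = x ∧ γ L = y ∧
      L ≤ A * dist x y ∧ ∀ t ∈ Set.Icc (0:ℝ) L, min t (L - t) ≤ A * distToBdry X (γ t) := by
  obtain ⟨L, hL, γ, hγ, h0, h1, hLA, ht⟩ := hXA x y
  refine ⟨L, hL, _, lipschitz_comp_projIcc hL hγ, by simpa, by simpa, hLA, fun t h => ?_⟩
  simpa [Set.projIcc_of_mem hL h] using ht t h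

lemma exists_integral_lt {A : ℝ} (hXA : IsUniformMS X A) (x y : X) {η : ℝ} (hη : 0 < η) :
    ∃ L : ℝ, 0 ≤ L ∧ ∃ γ : ℝ → X, LipschitzWith 1 γ ∧ γ 0 = x ∧ γ L = y ∧
      ∫ t in (0:ℝ)..L, (distToBdry X (γ t))⁻¹ < quasihyperbolic X x y + η := by
  obtain ⟨r, ⟨L, hL, γ, hγ, h0, h1, rfl⟩, hr⟩ := Real.lt_sInf_add_pos
    (s := {r : ℝ | ∃ L : ℝ, 0 ≤ L ∧ ∃ γ : ℝ → X,
      LipschitzOnWith 1 γ (Set.Icc 0 L) ∧ γ 0 = x ∧ γ L = y ∧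
      r = ∫ t in (0:ℝ)..L, (distToBdry X (γ t))⁻¹})
    (by
      obtain ⟨L, hL, γ, hγ, h0, h1, -⟩ := hXA x y
      exact ⟨_, L, hL, γ, hγ, h0, h1, rfl⟩) hη
  refine ⟨L, hL, _, lipschitz_comp_projIcc hL hγ, by simpa, by simpa, ?_⟩
  refine lt_of_eq_of_lt (intervalIntegral.integral_congr fun t ht => ?_) hr
  rw [Set.uIcc_of_le hL] at ht
  simp [Set.projIcc_of_mem hL ht]

section

variable (hd : ∀ x : X, 0 < distToBdry X x) {A : ℝ} (hXA : IsUniformMS X A)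
include hd hXA

lemma quasihyperbolic_comm_le (x y : X) : quasihyperbolic X x y ≤ quasihyperbolic X y x := by
  refine le_of_forall_pos_lt_add fun η hη => ?_
  obtain ⟨L, hL, γ, hγ, rfl, rfl, h⟩ := exists_integral_lt hXA y x hη
  refine lt_of_le_of_lt ?_ h
  have hγr := hγ.comp (lipschitzWith_const_sub L)
  rw [mul_one] at hγr
  have h2 := quasihyperbolic_le_integral hd hγr hL
  simp only [Function.comp, sub_zero, sub_self] at h2
  rwa [intervalIntegral.integral_comp_sub_left (fun t => (distToBdry X (γ t))⁻¹) L,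
    sub_self, sub_zero] at h2

lemma quasihyperbolic_comm (x y : X) : quasihyperbolic X x y = quasihyperbolic X y x :=
  (quasihyperbolic_comm_le hd hXA x y).antisymm (quasihyperbolic_comm_le hd hXA y x)

lemma quasihyperbolic_triangle (x y z : X) :
    quasihyperbolic X x z ≤ quasihyperbolic X x y + quasihyperbolic X y z := by
  refine le_of_forall_pos_lt_add fun η hη => ?_
  obtain ⟨a, ha, α, hα, rfl, hy, h1⟩ := exists_integral_lt hXA x y (half_pos hη)
  obtain ⟨b, hb, β, hβ, rfl, rfl, h2⟩ := exists_integral_lt hXA y z (half_pos hη)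
  set γ : ℝ → X := fun t => if t ≤ a then α t else β (t - a) with hγdef
  have key : ∀ s t, s ≤ t → dist (γ s) (γ t) ≤ t - s := by
    intro s t hst
    by_cases hs : s ≤ a <;> by_cases ht : t ≤ a <;> simp only [hγdef, hs, ht, if_true, if_false]
    · exact dist_le_sub_of_lipschitz hα hst
    · have e1 := dist_le_sub_of_lipschitz hα hs
      have e2 := dist_le_sub_of_lipschitz hβ (by linarith : 0 ≤ t - a)
      rw [hy] at e1
      linarith [dist_triangle (α s) (β 0) (β (t - a))]
    · linarith
    · linarith [dist_le_sub_of_lipschitz hβ (by linarith : s - a ≤ t - a)]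
  have hγ : LipschitzWith 1 γ := by
    refine LipschitzWith.of_dist_le_mul fun s t => ?_
    rw [NNReal.coe_one, one_mul, Real.dist_eq]
    rcases le_total s t with h | h
    · rw [abs_sub_comm]; exact (key s t h).trans (le_abs_self _)
    · rw [dist_comm]; exact (key t s h).trans (le_abs_self _)
  have hright : ∀ t, 0 ≤ t → γ (t + a) = β t := by
    intro t ht
    rcases ht.eq_or_lt with rfl | ht
    · simp [hγdef, hy]
    · simp [hγdef, not_le.2 ht]
  have h3 := quasihyperbolic_le_integral hd hγ (by linarith : 0 ≤ b + a)
  rw [hright b hb, show γ 0 = α 0 by simp [hγdef, ha]] at h3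
  have hc := continuous_inv_distToBdry hd hγ
  rw [← intervalIntegral.integral_add_adjacent_intervals (hc.intervalIntegrable 0 a)
    (hc.intervalIntegrable a (b + a))] at h3
  have e1 : ∫ t in (0:ℝ)..a, (distToBdry X (γ t))⁻¹ = ∫ t in (0:ℝ)..a, (distToBdry X (α t))⁻¹ := by
    refine intervalIntegral.integral_congr fun t ht => ?_
    rw [Set.uIcc_of_le ha] at ht
    simp [hγdef, ht.2]
  have e2 : ∫ t in a..(b + a), (distToBdry X (γ t))⁻¹
      = ∫ t in (0:ℝ)..b, (distToBdry X (β t))⁻¹ := by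
    have := intervalIntegral.integral_comp_add_right (a := 0) (b := b)
      (fun t => (distToBdry X (γ t))⁻¹) a
    rw [zero_add] at this
    rw [← this]
    refine intervalIntegral.integral_congr fun t ht => ?_
    rw [Set.uIcc_of_le hb] at ht
    simp only [hright t ht.1]
  linarith

/-- In a uniform space the quasihyperbolic metric is controlled by a logarithmic expression
in the distance and the distances to the boundary. -/
lemma quasihyperbolic_le_log (hA : 1 ≤ A) (x y : X) :
    quasihyperbolic X x y ≤ (1 + 2 * A) *
      (Real.log (1 + A * dist x y / distToBdry X x) +
        Real.log (1 + A * dist x y / distToBdry X y)) := by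
  obtain ⟨L, hL, γ, hγ, hx, hy, hLA, hu⟩ := exists_uniform_curve hXA x y
  have hdx := hd x
  have hdy := hd y
  have h1 := quasihyperbolic_le_integral hd hγ hL
  rw [hx, hy] at h1
  have hi1 : IntervalIntegrable (fun t => (t + distToBdry X x)⁻¹) MeasureTheory.volume 0 L := by
    refine ContinuousOn.intervalIntegrable ?_
    rw [Set.uIcc_of_le hL]
    exact ContinuousOn.inv₀ (by fun_prop) fun t ht => by linarith [ht.1]
  have hi2 : IntervalIntegrable (fun t => (L + distToBdry X y - t)⁻¹)
      MeasureTheory.volume 0 L := by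
    refine ContinuousOn.intervalIntegrable ?_
    rw [Set.uIcc_of_le hL]
    exact ContinuousOn.inv₀ (by fun_prop) fun t ht => by linarith [ht.2]
  have h2 : ∫ t in (0:ℝ)..L, (distToBdry X (γ t))⁻¹ ≤ ∫ t in (0:ℝ)..L,
      (1 + 2 * A) * ((t + distToBdry X x)⁻¹ + (L + distToBdry X y - t)⁻¹) := by
    refine intervalIntegral.integral_mono_on hL
      ((continuous_inv_distToBdry hd hγ).intervalIntegrable _ _) ((hi1.add hi2).const_mul _)
      fun t ht => ?_
    have hg := hd (γ t)
    have hA0 : 0 < 1 + 2 * A := by linarith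
    have p1 : 0 < t + distToBdry X x := by linarith [ht.1]
    have p2 : 0 < L + distToBdry X y - t := by linarith [ht.2]
    have aux : ∀ r : ℝ, 0 < r → r ≤ (1 + 2 * A) * distToBdry X (γ t) →
        (distToBdry X (γ t))⁻¹ ≤ (1 + 2 * A) * r⁻¹ := by
      intro r hr h
      rw [← div_eq_mul_inv, inv_le_iff_one_le_mul₀ hg, div_mul_eq_mul_div, le_div_iff₀ hr]
      linarith
    have b1 := distToBdry_le_add_dist x (γ t)
    have b2 := distToBdry_le_add_dist y (γ t)
    have c1 := dist_le_sub_of_lipschitz hγ ht.1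
    have c2 := dist_le_sub_of_lipschitz hγ ht.2
    rw [hx] at c1
    rw [hy, dist_comm] at c2
    have i1 := inv_pos.2 p1
    have i2 := inv_pos.2 p2
    rcases min_le_iff.1 (hu t ht) with h | h
    · have := aux _ p1 (by linarith)
      nlinarith [mul_pos hA0 i2]
    · have := aux _ p2 (by linarith)
      nlinarith [mul_pos hA0 i1]
  have hlog1 : ∫ t in (0:ℝ)..L, (t + distToBdry X x)⁻¹ = Real.log (1 + L / distToBdry X x) := by
    rw [intervalIntegral.integral_comp_add_right (fun t => t⁻¹),
      integral_inv_of_pos (by linarith) (by linarith)]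
    congr 1
    rw [zero_add, add_div, div_self hdx.ne', add_comm]
  have hlog2 : ∫ t in (0:ℝ)..L, (L + distToBdry X y - t)⁻¹
      = Real.log (1 + L / distToBdry X y) := by
    rw [intervalIntegral.integral_comp_sub_left (fun t => t⁻¹),
      integral_inv_of_pos (by linarith) (by linarith)]
    congr 1
    rw [sub_zero, add_sub_cancel_left, add_div, div_self hdy.ne', add_comm]
  rw [intervalIntegral.integral_const_mul, intervalIntegral.integral_add hi1 hi2, hlog1,
    hlog2] at h2
  refine (h1.trans h2).trans ?_
  gcongr

end

lemma exists_linear_le_exp {A C : ℝ} (hA : 1 ≤ A) (hC : 0 < C) :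
    ∃ K : ℝ, 0 < K ∧ ∀ h, K ≤ h → 2 * Real.exp 1 * (1 + A * h) ≤ Real.exp (h / (2 * C)) := by
  have he : 0 < Real.exp 1 := Real.exp_pos 1
  refine ⟨max 1 (32 * Real.exp 1 * A * C ^ 2), by positivity, fun h hh => ?_⟩
  have h1 : 1 ≤ h := (le_max_left _ _).trans hh
  have h2 : 32 * Real.exp 1 * A * C ^ 2 ≤ h := (le_max_right _ _).trans hh
  have h3 := Real.quadratic_le_exp_of_nonneg (x := h / (2 * C)) (by positivity)
  have h4 : 4 * Real.exp 1 * A * h ≤ (h / (2 * C)) ^ 2 / 2 := by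
    rw [div_pow, div_div, le_div_iff₀ (by positivity)]
    nlinarith
  have h5 : 1 + A * h ≤ 2 * (A * h) := by nlinarith
  have h6 : 0 ≤ h / (2 * C) := by positivity
  nlinarith

/-- A positive function bounded by `δ` whose reciprocal has integrals growing at most
logarithmically lives on an interval of length comparable to `δ`. -/
lemma exists_length_bound {A C : ℝ} (hA : 1 ≤ A) (hC : 1 ≤ C) :
    ∃ Λ : ℝ, 0 < Λ ∧ ∀ (T δ : ℝ) (g : ℝ → ℝ), 0 < δ → Continuous g → (∀ u, 0 < g u) →
      (∀ u ∈ Set.Ioo 0 T, g u ≤ δ) →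
      (∀ u ∈ Set.Icc 0 T, ∫ t in (0:ℝ)..u, (g t)⁻¹ ≤
        C * (Real.log (1 + A * u / g u) + Real.log (1 + A * u / δ)) + 1) →
      T ≤ Λ * δ := by
  have hC0 : 0 < C := by linarith
  have hA0 : 0 < A := by linarith
  obtain ⟨K, hK, hKexp⟩ := exists_linear_le_exp hA hC0
  refine ⟨K * Real.exp (2 * C * A), by positivity, fun T δ g hδ hg hpos hle hint => ?_⟩
  by_contra! hT
  have hKT : K * δ < T := by
    have : 1 ≤ Real.exp (2 * C * A) := Real.one_le_exp (by positivity)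
    have : K * δ ≤ K * δ * Real.exp (2 * C * A) := le_mul_of_one_le_right (by positivity) this
    linarith
  have hKδ : 0 < K * δ := by positivity
  have hT0 : 0 < T := hKδ.trans hKT
  have hgi : Continuous fun t => (g t)⁻¹ := hg.inv₀ fun u => (hpos u).ne'
  set H : ℝ → ℝ := fun u => ∫ t in (0:ℝ)..u, (g t)⁻¹ with hH
  have hHd : ∀ u, HasDerivAt H (g u)⁻¹ u := fun u => (hgi.integral_hasStrictDerivAt 0 u).hasDerivAt
  have hHge : ∀ u ∈ Set.Icc 0 T, u / δ ≤ H u := by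
    intro u hu
    have h := intervalIntegral.integral_mono_on_of_le_Ioo (μ := MeasureTheory.volume)
      (f := fun _ => δ⁻¹) (g := fun t => (g t)⁻¹) hu.1
      (continuous_const.intervalIntegrable _ _) (hgi.intervalIntegrable _ _)
      (fun t ht => inv_anti₀ (hpos t) (hle t ⟨ht.1, ht.2.trans_le hu.2⟩))
    simpa [div_eq_mul_inv] using h
  have hgrow : ∀ u ∈ Set.Icc (K * δ) T, Real.exp (H u / (2 * C)) ≤ A * u / g u := by
    intro u hu
    have hu0 : 0 < u := hKδ.trans_le hu.1
    have huT : u ∈ Set.Icc 0 T := ⟨hu0.le, hu.2⟩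
    have hgu := hpos u
    have h1 := hHge u huT
    have h2 := hKexp (H u) (((le_div_iff₀ hδ).2 hu.1).trans h1)
    have h3 : H u ≤ C * (Real.log (1 + A * u / g u) + Real.log (1 + A * u / δ)) + 1 := hint u huT
    have hP : 0 < 1 + A * u / g u := by positivity
    have hQ : 0 < 1 + A * u / δ := by positivity
    have hQh : 1 + A * u / δ ≤ 1 + A * H u := by
      rw [mul_div_assoc]
      gcongr
    have h4 : Real.exp (H u / C) ≤ Real.exp 1 * ((1 + A * u / g u) * (1 + A * u / δ)) := by
      rw [← Real.exp_log (mul_pos hP hQ), ← Real.exp_add, Real.log_mul hP.ne' hQ.ne']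
      refine Real.exp_le_exp.2 ?_
      rw [div_le_iff₀ hC0]
      nlinarith
    have h5 : Real.exp (H u / C) = Real.exp (H u / (2 * C)) * Real.exp (H u / (2 * C)) := by
      rw [← Real.exp_add]
      congr 1
      field_simp
      ring
    rw [h5] at h4
    set E := Real.exp (H u / (2 * C))
    have hE1 : 1 ≤ E := Real.one_le_exp (div_nonneg ((by positivity : 0 ≤ u / δ).trans h1)
      (by positivity))
    have he := Real.exp_pos 1
    have h6 : E * (2 * E) ≤ E * (1 + A * u / g u) := by
      have h7 : 2 * Real.exp 1 * (1 + A * u / δ) ≤ E := le_trans (by gcongr) h2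
      nlinarith [mul_le_mul_of_nonneg_left h7 hP.le]
    have := le_of_mul_le_mul_left h6 (by linarith)
    linarith
  have hΦ : ∀ u ∈ Set.Icc (K * δ) T, HasDerivAt
      (fun u => -(2 * C * A) * Real.exp (-(H u / (2 * C))) - Real.log u)
      (A * Real.exp (-(H u / (2 * C))) * (g u)⁻¹ - u⁻¹) u := by
    intro u hu
    have hu0 : 0 < u := hKδ.trans_le hu.1
    have h := ((((hHd u).div_const (2 * C)).neg.exp).const_mul (-(2 * C * A))).sub
      (Real.hasDerivAt_log hu0.ne')
    refine h.congr_deriv ?_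
    simp only [Pi.neg_apply]
    field_simp
  have hmono : MonotoneOn (fun u => -(2 * C * A) * Real.exp (-(H u / (2 * C))) - Real.log u)
      (Set.Icc (K * δ) T) := by
    refine monotoneOn_of_deriv_nonneg (convex_Icc _ _)
      (fun u hu => (hΦ u hu).continuousAt.continuousWithinAt)
      (fun u hu => (hΦ u (interior_subset hu)).differentiableAt.differentiableWithinAt)
      fun u hu => ?_
    have hu' := interior_subset hu
    have hu0 : 0 < u := hKδ.trans_le hu'.1
    have h := hgrow u hu'
    rw [(hΦ u hu').deriv, sub_nonneg, Real.exp_neg, ← one_div u, div_le_iff₀ hu0]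
    calc (1 : ℝ) = (Real.exp (H u / (2 * C)))⁻¹ * Real.exp (H u / (2 * C)) :=
          (inv_mul_cancel₀ (Real.exp_pos _).ne').symm
      _ ≤ (Real.exp (H u / (2 * C)))⁻¹ * (A * u / g u) := by gcongr
      _ = _ := by ring
  have h := hmono (Set.left_mem_Icc.2 hKT.le) (Set.right_mem_Icc.2 hKT.le) hKT.le
  have e1 : Real.exp (-(H (K * δ) / (2 * C))) ≤ 1 := by
    refine Real.exp_le_one_iff.2 (neg_nonpos.2 (div_nonneg ?_ (by positivity)))
    exact (div_nonneg hKδ.le hδ.le).trans (hHge _ ⟨hKδ.le, hKT.le⟩)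
  have e2 := Real.exp_pos (-(H T / (2 * C)))
  have hCA : 0 < 2 * C * A := by positivity
  have h7 : Real.log T ≤ 2 * C * A + Real.log (K * δ) := by
    simp only at h
    nlinarith [mul_pos hCA e2]
  have h8 := Real.exp_le_exp.2 h7
  rw [Real.exp_log hT0, Real.exp_add, Real.exp_log hKδ] at h8
  linarith

section

variable (hd : ∀ x : X, 0 < distToBdry X x) {A : ℝ} (hXA : IsUniformMS X A)
include hd hXA

/-- Along a curve that is quasihyperbolically length-minimizing from its starting point up to an
additive constant, staying `δ`-close to the boundary forces length at most a multiple of `δ`. -/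
lemma exists_near_geodesic_length_bound (hA : 1 ≤ A) :
    ∃ Λ : ℝ, 0 < Λ ∧ ∀ (T δ : ℝ) (γ : ℝ → X), 0 < δ → LipschitzWith 1 γ →
      δ ≤ distToBdry X (γ 0) → (∀ u ∈ Set.Ioo 0 T, distToBdry X (γ u) ≤ δ) →
      (∀ u ∈ Set.Icc 0 T, ∫ t in (0:ℝ)..u, (distToBdry X (γ t))⁻¹ ≤
        quasihyperbolic X (γ u) (γ 0) + 1) →
      T ≤ Λ * δ := by
  obtain ⟨Λ, hΛ, h⟩ := exists_length_bound hA (C := 1 + 2 * A) (by linarith)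
  refine ⟨Λ, hΛ, fun T δ γ hδ hγ h0 hle hint => h T δ (fun u => distToBdry X (γ u)) hδ
    (continuous_distToBdry.comp hγ.continuous) (fun _ => hd _) hle fun u hu => ?_⟩
  refine (hint u hu).trans ?_
  have h1 := quasihyperbolic_le_log hd hXA hA (γ u) (γ 0)
  have h2 : dist (γ u) (γ 0) ≤ u := by
    rw [dist_comm]
    simpa using dist_le_sub_of_lipschitz hγ hu.1
  have hu0 := hu.1
  have hdu := hd (γ u)
  have hA0 : 0 ≤ A := by linarith
  have : quasihyperbolic X (γ u) (γ 0) ≤ (1 + 2 * A) *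
      (Real.log (1 + A * u / distToBdry X (γ u)) + Real.log (1 + A * u / δ)) := by
    refine h1.trans ?_
    have := hd (γ 0)
    gcongr
  linarith

/-- Points at distance at least `ε` are joined by an almost minimizing quasihyperbolic curve
passing through a point that is far from the boundary and close to the first endpoint. -/
lemma exists_central_point (hA : 1 ≤ A) {ε : ℝ} (hε : 0 < ε) :
    ∃ δ R : ℝ, 0 < δ ∧ ∀ x y : X, ε ≤ dist x y → ∃ z : X, δ ≤ distToBdry X z ∧ dist x z ≤ R ∧
      quasihyperbolic X x z + quasihyperbolic X z y ≤ quasihyperbolic X x y + 1 := by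
  obtain ⟨Λ, hΛ, hbound⟩ := exists_near_geodesic_length_bound hd hXA hA
  refine ⟨ε / (2 * Λ), Λ * (ε / (2 * Λ)), by positivity, fun x y hxy => ?_⟩
  set δ := ε / (2 * Λ) with hδdef
  have hδ : 0 < δ := by positivity
  obtain ⟨L, hL, γ, hγ, rfl, rfl, hlen⟩ := exists_integral_lt hXA x y one_pos
  have hcont : Continuous fun t => distToBdry X (γ t) :=
    continuous_distToBdry.comp hγ.continuous
  have hci := continuous_inv_distToBdry hd hγ
  have hsub : ∀ s t, 0 ≤ s → s ≤ t → t ≤ L →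
      ∫ r in s..t, (distToBdry X (γ r))⁻¹ ≤ quasihyperbolic X (γ s) (γ t) + 1 := by
    intro s t hs hst htL
    have i1 := intervalIntegral.integral_add_adjacent_intervals
      (hci.intervalIntegrable (μ := MeasureTheory.volume) 0 s) (hci.intervalIntegrable s t)
    have i2 := intervalIntegral.integral_add_adjacent_intervals
      (hci.intervalIntegrable (μ := MeasureTheory.volume) 0 t) (hci.intervalIntegrable t L)
    have q1 := quasihyperbolic_le_integral hd hγ hs
    have q2 := quasihyperbolic_le_integral hd hγ htL
    have t1 := quasihyperbolic_triangle hd hXA (γ 0) (γ s) (γ L)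
    have t2 := quasihyperbolic_triangle hd hXA (γ s) (γ t) (γ L)
    linarith
  have hback : ∀ t₀ η, 0 < η → t₀ ∈ Set.Icc 0 L → η ≤ distToBdry X (γ t₀) →
      (∀ t ∈ Set.Ioo 0 t₀, distToBdry X (γ t) ≤ η) → t₀ ≤ Λ * η := by
    intro t₀ η hη ht₀ h1 h2
    have hγr := hγ.comp (lipschitzWith_const_sub t₀)
    rw [mul_one] at hγr
    refine hbound t₀ η _ hη hγr (by simpa using h1)
      (fun u hu => h2 _ ⟨by linarith [hu.2], by linarith [hu.1]⟩) fun u hu => ?_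
    simp only [Function.comp, sub_zero]
    rw [intervalIntegral.integral_comp_sub_left (fun t => (distToBdry X (γ t))⁻¹) t₀, sub_zero]
    exact hsub _ _ (by linarith [hu.2]) (by linarith [hu.1]) ht₀.2
  have hfwd : ∀ t₀ η, 0 < η → t₀ ∈ Set.Icc 0 L → η ≤ distToBdry X (γ t₀) →
      (∀ t ∈ Set.Ioo t₀ L, distToBdry X (γ t) ≤ η) → L - t₀ ≤ Λ * η := by
    intro t₀ η hη ht₀ h1 h2
    have hr : LipschitzWith 1 (fun t : ℝ => t + t₀) := LipschitzWith.of_dist_le_mul (by simp)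
    have hγr := hγ.comp hr
    rw [mul_one] at hγr
    refine hbound (L - t₀) η _ hη hγr (by simpa using h1)
      (fun u hu => h2 _ ⟨by linarith [hu.1], by linarith [hu.2]⟩) fun u hu => ?_
    simp only [Function.comp, zero_add]
    rw [intervalIntegral.integral_comp_add_right (fun t => (distToBdry X (γ t))⁻¹) t₀, zero_add,
      quasihyperbolic_comm hd hXA]
    exact hsub _ _ ht₀.1 (by linarith [hu.1]) (by linarith [hu.2])
  obtain ⟨t₁, ht₁, hmax⟩ := isCompact_Icc.exists_isMaxOn (Set.nonempty_Icc.2 hL)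
    hcont.continuousOn
  have hδt₁ : δ ≤ distToBdry X (γ t₁) := by
    have b1 := hback t₁ _ (hd _) ht₁ le_rfl fun t ht => hmax ⟨ht.1.le, ht.2.le.trans ht₁.2⟩
    have b2 := hfwd t₁ _ (hd _) ht₁ le_rfl fun t ht => hmax ⟨ht₁.1.trans ht.1.le, ht.2.le⟩
    have b3 := dist_le_sub_of_lipschitz hγ hL
    rw [hδdef, div_le_iff₀ (by positivity)]
    linarith
  obtain ⟨t₀, ⟨ht₀, hδt₀⟩, hmin⟩ :=
    (isCompact_Icc.inter_right (isClosed_le continuous_const hcont) :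
      IsCompact (Set.Icc 0 L ∩ {t | δ ≤ distToBdry X (γ t)})).exists_isLeast
      ⟨t₁, ht₁, hδt₁⟩
  refine ⟨γ t₀, hδt₀, ?_, ?_⟩
  · refine (dist_le_sub_of_lipschitz hγ ht₀.1).trans ?_
    rw [sub_zero]
    refine hback t₀ δ hδ ht₀ hδt₀ fun t ht => ?_
    by_contra! hlt
    exact absurd (hmin ⟨⟨ht.1.le, ht.2.le.trans ht₀.2⟩, hlt.le⟩) (not_le.2 ht.2)
  · have i1 := intervalIntegral.integral_add_adjacent_intervals
      (hci.intervalIntegrable (μ := MeasureTheory.volume) 0 t₀) (hci.intervalIntegrable t₀ L)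
    have q1 := quasihyperbolic_le_integral hd hγ ht₀.1
    have q2 := quasihyperbolic_le_integral hd hγ ht₀.2
    linarith

/-- In a bounded part of a uniform space, points that are apart in the original metric have
bounded Gromov product in the quasihyperbolic metric. -/
lemma exists_gromovProd_le (hA : 1 ≤ A) (p : X) (M : ℝ) {ε : ℝ} (hε : 0 < ε) :
    ∃ B : ℝ, ∀ x y : X, dist x p ≤ M → ε ≤ dist x y →
      gromovProd (quasihyperbolic X) p x y ≤ B := by
  obtain ⟨δ, R, hδ, hz⟩ := exists_central_point hd hXA hA hε
  refine ⟨(1 + 2 * A) * (Real.log (1 + A * (R + M) / δ) +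
    Real.log (1 + A * (R + M) / distToBdry X p)) + 1 / 2, fun x y hx hxy => ?_⟩
  obtain ⟨z, hδz, hxz, hk⟩ := hz x y hxy
  have hzp : dist z p ≤ R + M := by
    have := dist_triangle z x p
    rw [dist_comm z x] at this
    linarith
  have hA0 : 0 ≤ A := by linarith
  have hdp := hd p
  have hkz : quasihyperbolic X z p ≤ (1 + 2 * A) * (Real.log (1 + A * (R + M) / δ) +
      Real.log (1 + A * (R + M) / distToBdry X p)) := by
    refine (quasihyperbolic_le_log hd hXA hA z p).trans ?_
    have := hd z
    have : 0 ≤ R + M := dist_nonneg.trans hzp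
    gcongr
  have t1 := quasihyperbolic_triangle hd hXA x z p
  have t2 := quasihyperbolic_triangle hd hXA y z p
  rw [quasihyperbolic_comm hd hXA y z] at t2
  unfold gromovProd
  linarith

end

/-- a bounded Gromov sequence for the quasihyperbolic metric of a
uniform space is a Cauchy sequence in the original metric. -/
theorem bounded_gromov_sequence_is_cauchy
    {X : Type u} [MetricSpace X] (A : ℝ) (hA : 1 ≤ A)
    (hXA : IsUniformMS X A) (hd : ∀ x : X, 0 < distToBdry X x) (p : X)
    (x : ℕ → X)
    (hg : Tendsto (fun q : ℕ × ℕ =>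
        gromovProd (quasihyperbolic X) p (x q.1) (x q.2)) atTop atTop)
    (hb : ∃ M : ℝ, ∀ i : ℕ, dist (x i) p ≤ M) :
    CauchySeq x := by
  obtain ⟨M, hM⟩ := hb
  refine Metric.cauchySeq_iff.2 fun ε hε => ?_
  obtain ⟨B, hB⟩ := exists_gromovProd_le hd hXA hA p M hε
  obtain ⟨⟨m, n⟩, hN⟩ := Filter.eventually_atTop.1 (hg.eventually_gt_atTop B)
  refine ⟨max m n, fun i hi j hj => ?_⟩
  by_contra! h
  have := hN (i, j) ⟨(le_max_left m n).trans hi, (le_max_right m n).trans hj⟩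
  exact absurd (hB _ _ (hM i) h) (not_le.2 this)

end
end

section
/- Let A, B ≥ 1, let (X,d) be an A-uniform metric space with d(x) > 0 for every x ∈ X, and let k be its quasihyperbolic metric. Let x, y, z, u ∈ X satisfy max(d(x,y), d(x,z)) ≤ (1/2)·d(x,u) and 0 < (1/2)·d(x,z) ≤ d(x,y). Let α : [0,L] → X be a B-uniform 1-Lipschitz curve from x to u, and set b = α(d(x,y)) and c = α(d(x,z)). Then k(b,c) ≤ 4A²·log(1 + 6B·d(x,y)/d(x,z)). -/
open Metric Filter Set

noncomputable section

universe u v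

theorem distToBdry_le_add_dist_s15 {X : Type u} [MetricSpace X] (p q : X) :
    distToBdry X p ≤ distToBdry X q + dist p q := by
  unfold distToBdry
  rw [← UniformSpace.Completion.dist_eq p q]
  exact Metric.infDist_le_infDist_add_dist

theorem lipschitzWith_distToBdry (X : Type u) [MetricSpace X] :
    LipschitzWith 1 (distToBdry X) :=
  LipschitzWith.of_le_add distToBdry_le_add_dist_s15

theorem quasihyperbolic_le_integral_s15 {X : Type u} [MetricSpace X] {l : ℝ} (hl : 0 ≤ l)
    {γ : ℝ → X} (hγ : LipschitzOnWith 1 γ (Set.Icc 0 l)) :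
    quasihyperbolic X (γ 0) (γ l) ≤ ∫ t in (0:ℝ)..l, (distToBdry X (γ t))⁻¹ := by
  refine csInf_le ⟨0, ?_⟩ ⟨l, hl, γ, hγ, rfl, rfl, rfl⟩
  rintro r ⟨l', hl', γ', -, -, -, rfl⟩
  exact intervalIntegral.integral_nonneg hl' fun t _ => inv_nonneg.2 Metric.infDist_nonneg

theorem integral_inv_le_mul_log {f : ℝ → ℝ} {h m C : ℝ} (hh : 0 ≤ h) (hm : 0 < m) (hC : 0 < C)
    (hf : ContinuousOn f (Set.Icc 0 h)) (hfm : ∀ t ∈ Set.Icc 0 h, t + m ≤ C * f t) :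
    ∫ t in (0:ℝ)..h, (f t)⁻¹ ≤ C * Real.log (1 + h / m) := by
  have hpos : ∀ t ∈ Set.Icc 0 h, 0 < f t := fun t ht =>
    pos_of_mul_pos_right (lt_of_lt_of_le (by linarith [ht.1]) (hfm t ht)) hC.le
  have hint : IntervalIntegrable (fun t => (f t)⁻¹) MeasureTheory.volume 0 h := by
    apply ContinuousOn.intervalIntegrable
    rw [Set.uIcc_of_le hh]
    exact hf.inv₀ fun t ht => (hpos t ht).ne'
  have hint' : IntervalIntegrable (fun t => C * (t + m)⁻¹) MeasureTheory.volume 0 h := by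
    apply ContinuousOn.intervalIntegrable
    rw [Set.uIcc_of_le hh]
    refine continuousOn_const.mul (ContinuousOn.inv₀ (by fun_prop) fun t ht => ?_)
    linarith [ht.1]
  calc ∫ t in (0:ℝ)..h, (f t)⁻¹ ≤ ∫ t in (0:ℝ)..h, C * (t + m)⁻¹ := by
        refine intervalIntegral.integral_mono_on hh hint hint' fun t ht => ?_
        have h0 : 0 < t + m := by linarith [ht.1]
        rw [← div_eq_mul_inv, inv_eq_one_div, div_le_div_iff₀ (hpos t ht) h0, one_mul]
        exact hfm t ht
    _ = C * Real.log (1 + h / m) := by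
        rw [intervalIntegral.integral_const_mul,
          intervalIntegral.integral_comp_add_right (fun t => t⁻¹),
          integral_inv_of_pos (by linarith) (by linarith)]
        congr 2
        field_simp
        ring

/-- The bound `k(p, q) ≤ 4A² log(1 + d(p, q) / m)` in an `A`-uniform space, for any positive
`m ≤ min(d(p), d(q))`. -/
theorem IsUniformMS.quasihyperbolic_le {X : Type u} [MetricSpace X] {A m : ℝ} (hA : 1 ≤ A)
    (hX : IsUniformMS X A) {p q : X} (hm : 0 < m) (hp : m ≤ distToBdry X p)
    (hq : m ≤ distToBdry X q) :
    quasihyperbolic X p q ≤ 4 * A ^ 2 * Real.log (1 + dist p q / m) := by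
  obtain ⟨l, hl, γ, hγ, rfl, rfl, hlA, hu⟩ := hX p q
  have hcont : ContinuousOn (fun t => distToBdry X (γ t)) (Set.Icc 0 l) :=
    (lipschitzWith_distToBdry X).continuous.comp_continuousOn hγ.continuousOn
  have hlow : ∀ t ∈ Set.Icc 0 l, m - min t (l - t) ≤ distToBdry X (γ t) := by
    intro t ht
    have h0 := hγ.dist_le_mul 0 ⟨le_rfl, hl⟩ t ht
    have h1 := hγ.dist_le_mul l ⟨hl, le_rfl⟩ t ht
    rw [Real.dist_eq, NNReal.coe_one, one_mul] at h0 h1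
    rw [zero_sub, abs_neg, abs_of_nonneg ht.1] at h0
    rw [abs_of_nonneg (by linarith [ht.2])] at h1
    have h2 := distToBdry_le_add_dist_s15 (γ 0) (γ t)
    have h3 := distToBdry_le_add_dist_s15 (γ l) (γ t)
    rcases min_choice t (l - t) with h | h <;> rw [h] <;> linarith
  have hbound : ∀ t ∈ Set.Icc 0 l, min t (l - t) + m / 2 ≤ 2 * A * distToBdry X (γ t) := by
    intro t ht
    have h0 : 0 ≤ distToBdry X (γ t) := Metric.infDist_nonneg
    nlinarith [hlow t ht, hu t ht]
  have hfirst : ∫ t in (0:ℝ)..(l / 2), (distToBdry X (γ t))⁻¹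
      ≤ 2 * A * Real.log (1 + (l / 2) / (m / 2)) := by
    refine integral_inv_le_mul_log (by linarith) (by linarith) (by linarith)
      (hcont.mono (Set.Icc_subset_Icc_right (by linarith))) fun t ht => ?_
    have := hbound t ⟨ht.1, by linarith [ht.2]⟩
    rwa [min_eq_left (by linarith [ht.2])] at this
  have hsecond : ∫ t in (l / 2)..l, (distToBdry X (γ t))⁻¹
      ≤ 2 * A * Real.log (1 + (l / 2) / (m / 2)) := by
    have hrev := intervalIntegral.integral_comp_sub_left (a := 0) (b := l / 2)
      (fun t => (distToBdry X (γ t))⁻¹) l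
    rw [sub_zero, sub_half] at hrev
    rw [← hrev]
    refine integral_inv_le_mul_log (f := fun t => distToBdry X (γ (l - t)))
      (by linarith) (by linarith) (by linarith) ?_ fun t ht => ?_
    · exact hcont.comp (f := fun t => l - t) (by fun_prop)
        fun t ht => ⟨by linarith [ht.2], by linarith [ht.1]⟩
    · have := hbound (l - t) ⟨by linarith [ht.2], by linarith [ht.1]⟩
      rwa [sub_sub_cancel, min_eq_right (by linarith [ht.2])] at this
  have hint : IntervalIntegrable (fun t => (distToBdry X (γ t))⁻¹) MeasureTheory.volume 0 l := by
    apply ContinuousOn.intervalIntegrable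
    rw [Set.uIcc_of_le hl]
    refine hcont.inv₀ fun t ht h => ?_
    have h1 := hbound t ht
    have h2 : 0 ≤ min t (l - t) := le_min ht.1 (by linarith [ht.2])
    rw [h] at h1
    linarith
  have hsplit := intervalIntegral.integral_add_adjacent_intervals
    (hint.mono_set (c := 0) (d := l / 2) (by
      rw [Set.uIcc_of_le hl, Set.uIcc_of_le (by linarith)]
      exact Set.Icc_subset_Icc_right (by linarith)))
    (hint.mono_set (c := l / 2) (d := l) (by
      rw [Set.uIcc_of_le hl, Set.uIcc_of_le (by linarith)]
      exact Set.Icc_subset_Icc_left (by linarith)))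
  have hr : 0 ≤ dist (γ 0) (γ l) / m := by positivity
  have hlog : Real.log (1 + (l / 2) / (m / 2)) ≤ A * Real.log (1 + dist (γ 0) (γ l) / m) := by
    rw [div_div_div_cancel_right₀ two_ne_zero, ← Real.log_rpow (by linarith)]
    apply Real.log_le_log (by positivity)
    calc 1 + l / m ≤ 1 + A * (dist (γ 0) (γ l) / m) := by
          rw [← mul_div_assoc]
          gcongr
      _ ≤ _ := one_add_mul_self_le_rpow_one_add (by linarith) hA
  calc quasihyperbolic X (γ 0) (γ l) ≤ ∫ t in (0:ℝ)..l, (distToBdry X (γ t))⁻¹ :=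
        quasihyperbolic_le_integral_s15 hl hγ
    _ ≤ 4 * A * Real.log (1 + (l / 2) / (m / 2)) := by linarith
    _ ≤ 4 * A * (A * Real.log (1 + dist (γ 0) (γ l) / m)) := by gcongr
    _ = 4 * A ^ 2 * Real.log (1 + dist (γ 0) (γ l) / m) := by ring

/-- quasihyperbolic distance estimate between two points on a
B-uniform curve. -/
theorem quasihyperbolic_estimate_on_uniform_curve
    {X : Type u} [MetricSpace X] (A B : ℝ) (hA : 1 ≤ A) (hB : 1 ≤ B)
    (hXA : IsUniformMS X A) (hd : ∀ x : X, 0 < distToBdry X x)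
    (x y z u : X) (L : ℝ) (α : ℝ → X)
    (h1 : max (dist x y) (dist x z) ≤ (1 / 2) * dist x u)
    (h2 : 0 < (1 / 2) * dist x z) (h3 : (1 / 2) * dist x z ≤ dist x y)
    (hL : 0 ≤ L) (hlip : LipschitzOnWith 1 α (Set.Icc 0 L))
    (hα0 : α 0 = x) (hαL : α L = u)
    (hLB : L ≤ B * dist x u)
    (hunif : ∀ t ∈ Set.Icc (0:ℝ) L, min t (L - t) ≤ B * distToBdry X (α t)) :
    quasihyperbolic X (α (dist x y)) (α (dist x z)) ≤
      4 * A ^ 2 * Real.log (1 + 6 * B * dist x y / dist x z) := by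
  have hxy : dist x y ≤ (1 / 2) * dist x u := (le_max_left _ _).trans h1
  have hxz : dist x z ≤ (1 / 2) * dist x u := (le_max_right _ _).trans h1
  have hB0 : 0 < B := by linarith
  have hz : 0 < dist x z := by linarith
  have hxuL : dist x u ≤ L := by
    have h := hlip.dist_le_mul 0 ⟨le_rfl, hL⟩ L ⟨hL, le_rfl⟩
    rwa [hα0, hαL, Real.dist_eq, NNReal.coe_one, one_mul, zero_sub, abs_neg,
      abs_of_nonneg hL] at h
  have hsI : dist x y ∈ Set.Icc 0 L := ⟨dist_nonneg, by linarith⟩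
  have htI : dist x z ∈ Set.Icc 0 L := ⟨dist_nonneg, by linarith⟩
  have hb := hunif _ hsI
  have hc := hunif _ htI
  rw [min_eq_left (by linarith)] at hb hc
  have hbc := hlip.dist_le_mul _ hsI _ htI
  rw [Real.dist_eq, NNReal.coe_one, one_mul] at hbc
  have habs : |dist x y - dist x z| ≤ dist x y := abs_le.2 ⟨by linarith, by linarith⟩
  have hm : 0 < dist x z / (2 * B) := by positivity
  refine (hXA.quasihyperbolic_le hA hm ?_ ?_).trans ?_
  · rw [div_le_iff₀ (by positivity)]
    linarith
  · rw [div_le_iff₀ (by positivity)]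
    linarith
  · rw [div_div_eq_mul_div]
    have hle : dist (α (dist x y)) (α (dist x z)) * (2 * B) ≤ 6 * B * dist x y := by
      nlinarith [mul_le_mul_of_nonneg_left (hbc.trans habs) hB0.le, mul_nonneg hB0.le hsI.1]
    gcongr

end
end
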